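/- arXiv:1302.0233 — 7 statements merged into one kernel-verified Lean document; each statement's English description precedes it below -/
import Mathlib

section
/- Let u and v be quasicontinuous functions on Ω. If u = v almost everywhere in Ω (with respect to Lebesgue measure), then u = v quasieverywhere in Ω, i.e. the set {x ∈ Ω : u(x) ≠ v(x)} has C_{p(·)}-capacity zero. -/
open MeasureTheory Filter Topology
open scoped ENNReal NNReal

/-- The Sobolev `p(·)`-capacity of a set `E ⊆ ℝⁿ`: the infimum of
`∫ (|u|^{p(x)} + |∇u|^{p(x)})` over all smooth `u` with `u ≥ 1` in a neighbourhood of `E`. -/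
noncomputable def pCapacity {n : ℕ} (p : EuclideanSpace ℝ (Fin n) → ℝ)
    (E : Set (EuclideanSpace ℝ (Fin n))) : ℝ≥0∞ :=
  ⨅ (u : EuclideanSpace ℝ (Fin n) → ℝ)
    (_ : ContDiff ℝ (⊤ : ℕ∞) u ∧ ∃ U : Set (EuclideanSpace ℝ (Fin n)),
          IsOpen U ∧ E ⊆ U ∧ ∀ x ∈ U, 1 ≤ u x),
    ∫⁻ x, ENNReal.ofReal (|u x| ^ p x + ‖fderiv ℝ u x‖ ^ p x)

/-- `p` is log-Hölder continuous. -/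
def LogHolder {n : ℕ} (p : EuclideanSpace ℝ (Fin n) → ℝ) : Prop :=
  ∃ L : ℝ, 0 < L ∧ ∀ x y : EuclideanSpace ℝ (Fin n),
    |p x - p y| ≤ L / Real.log (Real.exp 1 + 1 / ‖x - y‖)

/-- `u : Ω → [-∞,∞]` is quasicontinuous: for every `ε > 0` there is an open set `U`
with capacity `< ε` such that `u` restricted to `Ω \ U` is real-valued and continuous. -/
def Quasicontinuous {n : ℕ} (p : EuclideanSpace ℝ (Fin n) → ℝ)
    (Ω : Set (EuclideanSpace ℝ (Fin n))) (u : EuclideanSpace ℝ (Fin n) → EReal) : Prop :=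
  ∀ ε : ℝ, 0 < ε → ∃ U : Set (EuclideanSpace ℝ (Fin n)), IsOpen U ∧
    pCapacity p U < ENNReal.ofReal ε ∧
    (∀ x ∈ Ω \ U, u x ≠ ⊤ ∧ u x ≠ ⊥) ∧ ContinuousOn u (Ω \ U)

/-- A smooth cutoff of linear growth: nonnegative, and at least `1` on `[1, ∞)`. -/
noncomputable def smoothCutoff (t : ℝ) : ℝ := 2 * t ^ 2 / (1 + t ^ 2)

lemma smoothCutoff_nonneg (t : ℝ) : 0 ≤ smoothCutoff t := by
  unfold smoothCutoff; positivity

lemma one_le_smoothCutoff {t : ℝ} (ht : 1 ≤ t) : 1 ≤ smoothCutoff t := by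
  unfold smoothCutoff
  rw [le_div_iff₀ (by positivity)]
  nlinarith

lemma smoothCutoff_le_abs (t : ℝ) : smoothCutoff t ≤ |t| := by
  unfold smoothCutoff
  rw [div_le_iff₀ (by positivity), ← sq_abs]
  nlinarith [mul_nonneg (abs_nonneg t) (sq_nonneg (|t| - 1))]

lemma contDiff_smoothCutoff {k : WithTop ℕ∞} : ContDiff ℝ k smoothCutoff := by
  unfold smoothCutoff
  exact ContDiff.div (by fun_prop) (by fun_prop) fun t => by positivity

lemma hasDerivAt_smoothCutoff (t : ℝ) :
    HasDerivAt smoothCutoff (4 * t / (1 + t ^ 2) ^ 2) t := by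
  have h1 : HasDerivAt (fun s : ℝ => 2 * s ^ 2) (2 * (2 * t)) t := by
    simpa using (hasDerivAt_pow 2 t).const_mul 2
  have h2 : HasDerivAt (fun s : ℝ => 1 + s ^ 2) (2 * t) t := by
    simpa using (hasDerivAt_pow 2 t).const_add 1
  refine (h1.div h2 (by positivity)).congr_deriv ?_
  ring

lemma abs_deriv_smoothCutoff_le (t : ℝ) : |4 * t / (1 + t ^ 2) ^ 2| ≤ 2 := by
  rw [abs_div, abs_of_nonneg (by positivity : (0 : ℝ) ≤ (1 + t ^ 2) ^ 2),
    div_le_iff₀ (by positivity), abs_mul, abs_of_pos (by norm_num : (0 : ℝ) < 4), ← sq_abs t]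
  nlinarith [sq_nonneg (|t| - 1), sq_nonneg (|t| ^ 2)]

lemma norm_fderiv_smoothCutoff_comp_le {E : Type*} [NormedAddCommGroup E] [NormedSpace ℝ E]
    {φ : E → ℝ} {x : E} (hφ : DifferentiableAt ℝ φ x) :
    ‖fderiv ℝ (fun y => smoothCutoff (φ y)) x‖ ≤ 2 * ‖fderiv ℝ φ x‖ := by
  have h := (hasDerivAt_smoothCutoff (φ x)).comp_hasFDerivAt x hφ.hasFDerivAt
  have h' : fderiv ℝ (fun y => smoothCutoff (φ y)) x = _ := h.fderiv
  rw [h', norm_smul, Real.norm_eq_abs]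
  gcongr
  exact abs_deriv_smoothCutoff_le _

lemma rpow_le_four_rpow_mul_add {a b c q r : ℝ} (ha : 0 ≤ a) (hb : 0 ≤ b) (hc : 0 ≤ c)
    (hq : 0 ≤ q) (hqr : q ≤ r) (h : c ≤ 2 * a + 2 * b) :
    c ^ q ≤ 4 ^ r * (a ^ q + b ^ q) := by
  have hm : 0 ≤ max a b := le_max_of_le_left ha
  calc c ^ q ≤ (4 * max a b) ^ q := by
        gcongr
        linarith [le_max_left a b, le_max_right a b]
    _ = 4 ^ q * max a b ^ q := Real.mul_rpow (by norm_num) hm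
    _ ≤ 4 ^ r * (a ^ q + b ^ q) := by
        have : max a b ^ q ≤ a ^ q + b ^ q := by
          have := Real.rpow_nonneg ha q
          have := Real.rpow_nonneg hb q
          rcases max_choice a b with h | h <;> rw [h] <;> linarith
        gcongr
        norm_num

lemma pCapacity_interior_closure_le {n : ℕ} (p : EuclideanSpace ℝ (Fin n) → ℝ)
    (V : Set (EuclideanSpace ℝ (Fin n))) :
    pCapacity p (interior (closure V)) ≤ pCapacity p V := by
  unfold pCapacity
  refine le_iInf₂ fun φ hφ => iInf₂_le φ ⟨hφ.1, _, isOpen_interior, subset_rfl, fun x hx => ?_⟩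
  obtain ⟨hφs, U, -, hVU, hU⟩ := hφ
  have hclosed : IsClosed {y | 1 ≤ φ y} := isClosed_le continuous_const hφs.continuous
  exact closure_minimal (fun y hy => hU y (hVU hy)) hclosed (interior_subset hx)

lemma pCapacity_mono {n : ℕ} (p : EuclideanSpace ℝ (Fin n) → ℝ)
    {A B : Set (EuclideanSpace ℝ (Fin n))} (h : A ⊆ B) : pCapacity p A ≤ pCapacity p B := by
  unfold pCapacity
  refine le_iInf₂ fun φ hφ => iInf₂_le φ ⟨hφ.1, ?_⟩
  obtain ⟨-, U, hU, hBU, h1⟩ := hφ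
  exact ⟨U, hU, h.trans hBU, h1⟩

/-- Subadditivity of the capacity up to a multiplicative constant. -/
lemma pCapacity_union_le {n : ℕ} {p : EuclideanSpace ℝ (Fin n) → ℝ} (hp : Measurable p)
    {r : ℝ} (h0 : ∀ x, 0 ≤ p x) (hr : ∀ x, p x ≤ r) (A B : Set (EuclideanSpace ℝ (Fin n))) :
    pCapacity p (A ∪ B) ≤ ENNReal.ofReal (4 ^ r) * (pCapacity p A + pCapacity p B) := by
  have hK : ENNReal.ofReal (4 ^ r) ≠ 0 := by
    simpa using Real.rpow_pos_of_pos (by norm_num : (0 : ℝ) < 4) r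
  have key : pCapacity p (A ∪ B) / ENNReal.ofReal (4 ^ r) ≤ pCapacity p A + pCapacity p B := by
    conv_rhs => unfold pCapacity
    refine ENNReal.le_iInf₂_add_iInf₂ fun φ hφ ψ hψ => ?_
    obtain ⟨hφs, U, hU, hAU, h1U⟩ := hφ
    obtain ⟨hψs, V, hV, hBV, h1V⟩ := hψ
    refine ENNReal.div_le_of_le_mul' ?_
    refine (iInf₂_le (fun x => smoothCutoff (φ x) + smoothCutoff (ψ x))
      ⟨(contDiff_smoothCutoff.comp hφs).add (contDiff_smoothCutoff.comp hψs), U ∪ V, hU.union hV,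
        Set.union_subset_union hAU hBV, ?_⟩).trans ?_
    swap
    · rintro x (hx | hx)
      · linarith [one_le_smoothCutoff (h1U x hx), smoothCutoff_nonneg (ψ x)]
      · linarith [one_le_smoothCutoff (h1V x hx), smoothCutoff_nonneg (φ x)]
    have hmeas : Measurable fun x =>
        ENNReal.ofReal (|φ x| ^ p x + ‖fderiv ℝ φ x‖ ^ p x) := by
      have h1 : Measurable φ := hφs.continuous.measurable
      have h2 : Measurable (fderiv ℝ φ) := (hφs.continuous_fderiv (by simp)).measurable
      exact (((continuous_abs.measurable.comp h1).pow hp).add (h2.norm.pow hp)).ennreal_ofReal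
    rw [← lintegral_add_left hmeas, ← lintegral_const_mul' _ _ ENNReal.ofReal_ne_top]
    refine lintegral_mono fun x => ?_
    rw [← ENNReal.ofReal_add (by positivity) (by positivity), ← ENNReal.ofReal_mul (by positivity)]
    refine ENNReal.ofReal_le_ofReal ?_
    have dφ : DifferentiableAt ℝ φ x := hφs.differentiable (by simp) x
    have dψ : DifferentiableAt ℝ ψ x := hψs.differentiable (by simp) x
    have dc : ∀ t, DifferentiableAt ℝ smoothCutoff t := fun t =>
      (hasDerivAt_smoothCutoff t).differentiableAt
    have hval := rpow_le_four_rpow_mul_add (abs_nonneg (φ x)) (abs_nonneg (ψ x))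
      (abs_nonneg (smoothCutoff (φ x) + smoothCutoff (ψ x))) (h0 x) (hr x) (by
        rw [abs_of_nonneg (add_nonneg (smoothCutoff_nonneg _) (smoothCutoff_nonneg _))]
        linarith [smoothCutoff_le_abs (φ x), smoothCutoff_le_abs (ψ x), abs_nonneg (φ x),
          abs_nonneg (ψ x)])
    have hgrad := rpow_le_four_rpow_mul_add (norm_nonneg (fderiv ℝ φ x))
      (norm_nonneg (fderiv ℝ ψ x))
      (norm_nonneg (fderiv ℝ (fun y => smoothCutoff (φ y) + smoothCutoff (ψ y)) x))
      (h0 x) (hr x) (by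
        rw [fderiv_fun_add (f := fun y => smoothCutoff (φ y))
          (g := fun y => smoothCutoff (ψ y)) ((dc _).comp x dφ) ((dc _).comp x dψ)]
        exact (norm_add_le _ _).trans (add_le_add (norm_fderiv_smoothCutoff_comp_le dφ)
          (norm_fderiv_smoothCutoff_comp_le dψ)))
    linarith
  rwa [ENNReal.div_le_iff' hK ENNReal.ofReal_ne_top] at key

/-- If `u = v` a.e. in the open set `Ω` and both are continuous off the open set `V`, then the
points where they differ lie in the interior of the closure of `V`. -/
lemma setOf_ne_subset_interior_closure {X Y : Type*} [TopologicalSpace X] [MeasurableSpace X]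
    [OpensMeasurableSpace X] {μ : Measure X} [μ.IsOpenPosMeasure] [TopologicalSpace Y] [T2Space Y]
    {Ω V : Set X} (hΩ : IsOpen Ω) (hV : IsOpen V) {u v : X → Y} (hu : ContinuousOn u (Ω \ V))
    (hv : ContinuousOn v (Ω \ V)) (hae : ∀ᵐ x ∂(μ.restrict Ω), u x = v x) :
    {x ∈ Ω | u x ≠ v x} ⊆ interior (closure V) := by
  rintro x ⟨hxΩ, hne⟩
  by_cases hxV : x ∈ V
  · exact hV.subset_interior_closure hxV
  have hev : ∀ᶠ y in 𝓝[Ω \ V] x, u y ≠ v y :=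
    ((hu x ⟨hxΩ, hxV⟩).prodMk_nhds (hv x ⟨hxΩ, hxV⟩)).eventually
      (isClosed_diagonal.isOpen_compl.mem_nhds hne)
  obtain ⟨N, hN, hxN, hNsub⟩ := mem_nhdsWithin.1 hev
  refine mem_interior.2 ⟨N ∩ Ω, fun y hy => ?_, hN.inter hΩ, hxN, hxΩ⟩
  by_contra hyV
  have hopen : IsOpen ((N ∩ Ω) \ closure V) := (hN.inter hΩ).sdiff isClosed_closure
  refine (hopen.measure_pos μ ⟨y, hy, hyV⟩).ne' ?_
  rw [ae_restrict_iff' hΩ.measurableSet, ae_iff] at hae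
  refine measure_mono_null (fun z hz => ?_) hae
  have := hNsub ⟨hz.1.1, hz.1.2, fun h => hz.2 (subset_closure h)⟩
  simpa using ⟨hz.1.2, this⟩

/-- If `u` and `v` are quasicontinuous in `Ω` and `u = v` a.e. in `Ω`,
then `u = v` quasieverywhere in `Ω`. -/
theorem quasicontinuous_ae_eq_implies_qe
    {n : ℕ} (hn : 0 < n)
    (p : EuclideanSpace ℝ (Fin n) → ℝ) (hpmeas : Measurable p)
    (pm pp : ℝ) (hpm : 1 < pm) (hbd : ∀ x, pm ≤ p x ∧ p x ≤ pp)
    (hlog : LogHolder p)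
    (Ω : Set (EuclideanSpace ℝ (Fin n))) (hΩ : IsOpen Ω) (hΩne : Ω.Nonempty)
    (u v : EuclideanSpace ℝ (Fin n) → EReal)
    (hu : Quasicontinuous p Ω u) (hv : Quasicontinuous p Ω v)
    (hae : ∀ᵐ x ∂(volume.restrict Ω), u x = v x) :
    pCapacity p {x ∈ Ω | u x ≠ v x} = 0 := by
  have hK : 0 < (4 : ℝ) ^ pp := by positivity
  refine le_antisymm (ENNReal.le_of_forall_pos_le_add fun δ hδ _ => ?_) bot_le
  set ε : ℝ := δ / (2 * 4 ^ pp) with hε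
  have hεpos : 0 < ε := by positivity
  obtain ⟨U, hUo, hUc, -, hUu⟩ := hu ε hεpos
  obtain ⟨V, hVo, hVc, -, hVv⟩ := hv ε hεpos
  have hsub : {x ∈ Ω | u x ≠ v x} ⊆ interior (closure (U ∪ V)) :=
    setOf_ne_subset_interior_closure hΩ (hUo.union hVo)
      (hUu.mono (Set.sdiff_subset_sdiff_right Set.subset_union_left))
      (hVv.mono (Set.sdiff_subset_sdiff_right Set.subset_union_right)) hae
  calc pCapacity p {x ∈ Ω | u x ≠ v x}
      ≤ pCapacity p (U ∪ V) := (pCapacity_mono p hsub).trans (pCapacity_interior_closure_le p _)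
    _ ≤ ENNReal.ofReal (4 ^ pp) * (pCapacity p U + pCapacity p V) :=
        pCapacity_union_le hpmeas (fun x => by linarith [(hbd x).1]) (fun x => (hbd x).2) U V
    _ ≤ ENNReal.ofReal (4 ^ pp) * (ENNReal.ofReal ε + ENNReal.ofReal ε) := by gcongr
    _ = ENNReal.ofReal δ := by
        rw [← ENNReal.ofReal_add hεpos.le hεpos.le, ← ENNReal.ofReal_mul hK.le, hε]
        congr 1
        field_simp
        ring
    _ = 0 + δ := by simp
end

section
/- Let K ⊆ ℝⁿ be a compact set with C_{p(·)}(K) = 0. Then there exists a sequence (φ_j)_{j=1}^∞ of C^∞ functions on ℝⁿ with the following properties: (1) 0 ≤ φ_j ≤ 1 on ℝⁿ and φ_j ≡ 0 in a neighbourhood of K; (2) lim_{j→∞} ∫_{ℝⁿ} |∇φ_j(x)|^{p(x)} dx = 0; (3) φ_j → 1 almost everywhere in ℝⁿ and ∇φ_j → 0 almost everywhere in ℝⁿ as j → ∞. -/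
open MeasureTheory Filter Topology
open scoped ENNReal NNReal

/-- The derivative of `Real.smoothTransition` is bounded. -/
theorem exists_bound_deriv_smoothTransition :
    ∃ C : ℝ, 1 ≤ C ∧ ∀ t, ‖deriv Real.smoothTransition t‖ ≤ C := by
  have hcont : Continuous (deriv Real.smoothTransition) :=
    (Real.smoothTransition.contDiff (n := 1)).continuous_deriv le_rfl
  obtain ⟨C, hC⟩ := (isCompact_Icc (a := (0 : ℝ)) (b := 1)).exists_bound_of_continuousOn
    hcont.continuousOn
  refine ⟨max C 1, le_max_right _ _, fun t => ?_⟩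
  rcases lt_or_ge t 0 with h0 | h0
  · have : Real.smoothTransition =ᶠ[𝓝 t] fun _ => 0 := by
      filter_upwards [Iio_mem_nhds h0] with s hs
      exact Real.smoothTransition.zero_of_nonpos (le_of_lt hs)
    simp [this.deriv_eq]
  rcases lt_or_ge 1 t with h1 | h1
  · have : Real.smoothTransition =ᶠ[𝓝 t] fun _ => 1 := by
      filter_upwards [Ioi_mem_nhds h1] with s hs
      exact Real.smoothTransition.one_of_one_le (le_of_lt hs)
    simp [this.deriv_eq]
  exact (hC t ⟨h0, h1⟩).trans (le_max_left _ _)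

/-- The gradient of `1 - smoothTransition ∘ u` is controlled by the gradient of `u`. -/
theorem norm_fderiv_one_sub_smoothTransition_comp_le {E : Type*} [NormedAddCommGroup E]
    [NormedSpace ℝ E] {C : ℝ} (hC : ∀ t, ‖deriv Real.smoothTransition t‖ ≤ C)
    {u : E → ℝ} {x : E} (hu : DifferentiableAt ℝ u x) :
    ‖fderiv ℝ (fun y => 1 - Real.smoothTransition (u y)) x‖ ≤ C * ‖fderiv ℝ u x‖ := by
  have hg : HasDerivAt Real.smoothTransition (deriv Real.smoothTransition (u x)) (u x) :=
    ((Real.smoothTransition.contDiff (n := 1)).differentiable one_ne_zero _).hasDerivAt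
  have h := (hg.comp_hasFDerivAt x hu.hasFDerivAt).const_sub 1
  have h' : fderiv ℝ (fun y => 1 - Real.smoothTransition (u y)) x =
      -(deriv Real.smoothTransition (u x) • fderiv ℝ u x) := h.fderiv
  rw [h', norm_neg, norm_smul]
  gcongr
  exact hC _

/-- A sequence of nonnegative reals tends to zero if its `q`-th powers do, for some `q > 0`. -/
theorem tendsto_zero_of_tendsto_rpow_zero {ι : Type*} {l : Filter ι} {a : ι → ℝ} {q : ℝ}
    (hq : 0 < q) (ha : ∀ i, 0 ≤ a i) (h : Tendsto (fun i => a i ^ q) l (𝓝 0)) :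
    Tendsto a l (𝓝 0) := by
  have h' := h.rpow_const (p := q⁻¹) (Or.inr (inv_nonneg.2 hq.le))
  rw [Real.zero_rpow (inv_ne_zero hq.ne')] at h'
  exact h'.congr fun i => Real.rpow_rpow_inv (ha i) hq.ne'

/-- If the integrals of a sequence of nonnegative functions are summable, then the sequence tends
to zero almost everywhere. -/
theorem ae_tendsto_zero_of_tsum_lintegral_ne_top {α : Type*} [MeasurableSpace α] {μ : Measure α}
    {f : ℕ → α → ℝ} (hf : ∀ j, AEMeasurable (f j) μ) (hf0 : ∀ j x, 0 ≤ f j x)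
    (h : ∑' j, ∫⁻ x, ENNReal.ofReal (f j x) ∂μ ≠ ∞) :
    ∀ᵐ x ∂μ, Tendsto (fun j => f j x) atTop (𝓝 0) := by
  rw [← lintegral_tsum fun j => (hf j).ennreal_ofReal] at h
  filter_upwards [ae_lt_top' (AEMeasurable.tsum fun j => (hf j).ennreal_ofReal) h]
    with x hx
  have h0 := ENNReal.tendsto_atTop_zero_of_tsum_ne_top hx.ne
  have h1 := (ENNReal.tendsto_toReal ENNReal.zero_ne_top).comp h0
  exact h1.congr fun j => ENNReal.toReal_ofReal (hf0 j x)

/-- If `K` is compact with `C_{p(·)}(K) = 0`, then there is a sequence `φ_j` of smooth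
functions with `0 ≤ φ_j ≤ 1`, `φ_j ≡ 0` in a neighbourhood of `K`,
`∫_{ℝⁿ} |∇φ_j|^{p(x)} dx → 0`, and `φ_j → 1`, `∇φ_j → 0` a.e. -/
theorem exists_smooth_sequence_of_capacity_zero
    {n : ℕ}
    (p : EuclideanSpace ℝ (Fin n) → ℝ) (hpmeas : Measurable p)
    (pm pp : ℝ) (hpm : 1 < pm) (hbd : ∀ x, pm ≤ p x ∧ p x ≤ pp)
    (hlog : LogHolder p)
    (K : Set (EuclideanSpace ℝ (Fin n))) (hK : IsCompact K)
    (hcap : pCapacity p K = 0) :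
    ∃ φ : ℕ → EuclideanSpace ℝ (Fin n) → ℝ,
      (∀ j, ContDiff ℝ (⊤ : ℕ∞) (φ j)) ∧
      (∀ j x, φ j x ∈ Set.Icc (0 : ℝ) 1) ∧
      (∀ j, ∃ U : Set (EuclideanSpace ℝ (Fin n)), IsOpen U ∧ K ⊆ U ∧
        ∀ x ∈ U, φ j x = 0) ∧
      Tendsto (fun j => ∫⁻ x, ENNReal.ofReal (‖fderiv ℝ (φ j) x‖ ^ p x))
        atTop (nhds 0) ∧
      (∀ᵐ x : EuclideanSpace ℝ (Fin n), Tendsto (fun j => φ j x) atTop (nhds 1)) ∧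
      (∀ᵐ x : EuclideanSpace ℝ (Fin n),
        Tendsto (fun j => fderiv ℝ (φ j) x) atTop (nhds 0)) := by
  obtain ⟨C, hC1, hC⟩ := exists_bound_deriv_smoothTransition
  have hC0 : 0 ≤ C := zero_le_one.trans hC1
  obtain ⟨ε, hε, hεsum⟩ := ENNReal.exists_pos_sum_of_countable' (one_ne_zero (α := ℝ≥0∞)) ℕ
  have hu : ∀ j, ∃ u : EuclideanSpace ℝ (Fin n) → ℝ,
      (ContDiff ℝ (⊤ : ℕ∞) u ∧ ∃ U : Set (EuclideanSpace ℝ (Fin n)),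
        IsOpen U ∧ K ⊆ U ∧ ∀ x ∈ U, 1 ≤ u x) ∧
      ∫⁻ x, ENNReal.ofReal (|u x| ^ p x + ‖fderiv ℝ u x‖ ^ p x) < ε j := by
    intro j
    have hj : pCapacity p K < ε j := hcap ▸ hε j
    simpa only [pCapacity, iInf_lt_iff, exists_prop] using hj
  choose u hu hint using hu
  have hp0 : ∀ x, 0 < p x := fun x => by linarith [(hbd x).1]
  have hdiff : ∀ j x, DifferentiableAt ℝ (u j) x := fun j x =>
    (hu j).1.differentiable (by simp) x
  have hgrad : ∀ j x, ‖fderiv ℝ (fun y => 1 - Real.smoothTransition (u j y)) x‖ ≤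
      C * ‖fderiv ℝ (u j) x‖ := fun j x =>
    norm_fderiv_one_sub_smoothTransition_comp_le hC (hdiff j x)
  have hmeas : ∀ j, Measurable fun x => |u j x| ^ p x + ‖fderiv ℝ (u j) x‖ ^ p x := by
    intro j
    have h1 : Continuous (fderiv ℝ (u j)) := (hu j).1.continuous_fderiv (by simp)
    exact ((hu j).1.continuous.abs.measurable.pow hpmeas).add (h1.norm.measurable.pow hpmeas)
  have hsum : ∑' j, ∫⁻ x, ENNReal.ofReal (|u j x| ^ p x + ‖fderiv ℝ (u j) x‖ ^ p x) ≠ ∞ :=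
    ((ENNReal.tsum_le_tsum fun j => (hint j).le).trans_lt
      (hεsum.trans ENNReal.one_lt_top)).ne
  have hae := ae_tendsto_zero_of_tsum_lintegral_ne_top (fun j => (hmeas j).aemeasurable)
    (fun j x => by positivity) hsum
  refine ⟨fun j x => 1 - Real.smoothTransition (u j x), fun j => ?_, fun j x => ?_, fun j => ?_,
    ?_, ?_, ?_⟩
  · exact contDiff_const.sub (Real.smoothTransition.contDiff.comp (hu j).1)
  · exact ⟨sub_nonneg.2 (Real.smoothTransition.le_one _),
      sub_le_self _ (Real.smoothTransition.nonneg _)⟩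
  · obtain ⟨U, hU, hKU, h1⟩ := (hu j).2
    exact ⟨U, hU, hKU, fun x hx => by simp [Real.smoothTransition.one_of_one_le (h1 x hx)]⟩
  · have hle : ∀ j, ∫⁻ x, ENNReal.ofReal
        (‖fderiv ℝ (fun y => 1 - Real.smoothTransition (u j y)) x‖ ^ p x) ≤
        ENNReal.ofReal (C ^ pp) * ε j := by
      intro j
      calc _ ≤ ∫⁻ x, ENNReal.ofReal (C ^ pp) *
            ENNReal.ofReal (|u j x| ^ p x + ‖fderiv ℝ (u j) x‖ ^ p x) := by
            refine lintegral_mono fun x => ?_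
            rw [← ENNReal.ofReal_mul (by positivity)]
            refine ENNReal.ofReal_le_ofReal ?_
            calc _ ≤ (C * ‖fderiv ℝ (u j) x‖) ^ p x :=
                  Real.rpow_le_rpow (norm_nonneg _) (hgrad j x) (hp0 x).le
              _ = C ^ p x * ‖fderiv ℝ (u j) x‖ ^ p x :=
                  Real.mul_rpow hC0 (norm_nonneg _)
              _ ≤ C ^ pp * (|u j x| ^ p x + ‖fderiv ℝ (u j) x‖ ^ p x) := by
                  gcongr
                  · exact (hbd x).2
                  · exact le_add_of_nonneg_left (by positivity)
        _ = ENNReal.ofReal (C ^ pp) *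
            ∫⁻ x, ENNReal.ofReal (|u j x| ^ p x + ‖fderiv ℝ (u j) x‖ ^ p x) :=
            lintegral_const_mul _ (hmeas j).ennreal_ofReal
        _ ≤ _ := by
            gcongr
            exact (hint j).le
    have hε0 := ENNReal.tendsto_atTop_zero_of_tsum_ne_top (hεsum.trans ENNReal.one_lt_top).ne
    have hlim := ENNReal.Tendsto.const_mul hε0
      (Or.inr (ENNReal.ofReal_ne_top (r := C ^ pp)))
    rw [mul_zero] at hlim
    exact tendsto_of_tendsto_of_tendsto_of_le_of_le tendsto_const_nhds hlim
      (fun _ => zero_le) hle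
  · filter_upwards [hae] with x hx
    have h0 : Tendsto (fun j => u j x) atTop (𝓝 0) := by
      rw [tendsto_zero_iff_abs_tendsto_zero]
      exact tendsto_zero_of_tendsto_rpow_zero (hp0 x) (fun j => abs_nonneg _)
        (squeeze_zero (fun j => Real.rpow_nonneg (abs_nonneg _) _)
          (fun j => le_add_of_nonneg_right (Real.rpow_nonneg (norm_nonneg _) _)) hx)
    have h1 := (Real.smoothTransition.continuous.tendsto 0).comp h0
    rw [Real.smoothTransition.zero] at h1
    simpa using h1.const_sub 1
  · filter_upwards [hae] with x hx
    have h0 : Tendsto (fun j => ‖fderiv ℝ (u j) x‖) atTop (𝓝 0) :=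
      tendsto_zero_of_tendsto_rpow_zero (hp0 x) (fun j => norm_nonneg _)
        (squeeze_zero (fun j => by positivity)
          (fun j => le_add_of_nonneg_left (by positivity)) hx)
    exact squeeze_zero_norm (fun j => hgrad j x) (by simpa using h0.const_mul C)
end

section
/- Let G ⊆ ℝⁿ be open and connected, and let F ⊆ G be relatively closed in G (i.e. closed in the subspace topology of G) with C_{p(·)}(F) = 0. Then G ∖ F is connected. -/
open MeasureTheory Filter Topology
open scoped ENNReal NNReal

/-- A `C¹` function on the line that reaches `1` somewhere on `[0, 1]` has `W^{1,1}`-norm at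
least `1` there. -/
lemma one_le_lintegral_abs_add_abs_deriv {g g' : ℝ → ℝ} (hg : ∀ t, HasDerivAt g (g' t) t)
    (hg' : Continuous g') {t₀ : ℝ} (ht₀ : t₀ ∈ Set.Icc (0 : ℝ) 1) (h1 : 1 ≤ g t₀) :
    1 ≤ ∫⁻ t in Set.Icc (0 : ℝ) 1, ENNReal.ofReal (|g t| + |g' t|) := by
  have hgc : Continuous g := continuous_iff_continuousAt.2 fun t => (hg t).continuousAt
  have hint : ∀ {h : ℝ → ℝ}, Continuous h → IntegrableOn h (Set.Icc (0 : ℝ) 1) :=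
    fun hh => hh.continuousOn.integrableOn_Icc
  have key : ∀ s ∈ Set.Icc (0 : ℝ) 1, 1 - (∫ t in Set.Icc (0 : ℝ) 1, |g' t|) ≤ |g s| := by
    intro s hs
    have hftc : ∫ t in s..t₀, g' t = g t₀ - g s :=
      intervalIntegral.integral_eq_sub_of_hasDerivAt (fun t _ => hg t) (hg'.intervalIntegrable _ _)
    have hle : ‖∫ t in s..t₀, g' t‖ ≤ ∫ t in Set.Icc (0 : ℝ) 1, |g' t| := by
      refine (intervalIntegral.norm_integral_le_integral_norm_uIoc).trans ?_
      refine setIntegral_mono_set (hint hg'.abs) (ae_of_all _ fun t => abs_nonneg _)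
        (LE.le.eventuallyLE ?_)
      exact Set.uIoc_subset_uIcc.trans (Set.uIcc_subset_Icc hs ht₀)
    rw [hftc, Real.norm_eq_abs] at hle
    have := le_abs_self (g t₀ - g s)
    have := le_abs_self (g s)
    linarith
  have h2 : 1 - (∫ t in Set.Icc (0 : ℝ) 1, |g' t|) ≤ ∫ t in Set.Icc (0 : ℝ) 1, |g t| := by
    have := setIntegral_mono_on (hint continuous_const) (hint hgc.abs) measurableSet_Icc key
    simpa using this
  rw [← ofReal_integral_eq_lintegral_ofReal (hint (by fun_prop : Continuous fun t => |g t| + |g' t|))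
    (ae_of_all _ fun t => by positivity), integral_add (hint hgc.abs) (hint hg'.abs),
    ENNReal.one_le_ofReal]
  linarith

/-- If every translate of the segment `[a, b]` by a vector shorter than `ε` lies in `S` and meets
`{u ≥ 1}`, then the measure of an `ε`-ball is controlled by the `W^{1,1}`-norm of `u` on `S`. -/
lemma volume_ball_le_setLIntegral {n : ℕ} {u : EuclideanSpace ℝ (Fin n) → ℝ}
    (hu : ContDiff ℝ 1 u) {a b : EuclideanSpace ℝ (Fin n)} {ε : ℝ}
    {S : Set (EuclideanSpace ℝ (Fin n))} (hS : MeasurableSet S)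
    (hsub : ∀ z ∈ Metric.ball (0 : EuclideanSpace ℝ (Fin n)) ε, ∀ t ∈ Set.Icc (0 : ℝ) 1,
      z + (a + t • (b - a)) ∈ S)
    (hmeet : ∀ z ∈ Metric.ball (0 : EuclideanSpace ℝ (Fin n)) ε, ∃ t ∈ Set.Icc (0 : ℝ) 1,
      1 ≤ u (z + (a + t • (b - a)))) :
    volume (Metric.ball (0 : EuclideanSpace ℝ (Fin n)) ε) ≤
      ∫⁻ x in S, ENNReal.ofReal (|u x| + ‖b - a‖ * ‖fderiv ℝ u x‖) := by
  set f : EuclideanSpace ℝ (Fin n) → ℝ≥0∞ :=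
    fun x => ENNReal.ofReal (|u x| + ‖b - a‖ * ‖fderiv ℝ u x‖) with hf
  have hDc : Continuous (fderiv ℝ u) := hu.continuous_fderiv one_ne_zero
  have huc : Continuous u := hu.continuous
  have hfc : Continuous f := by
    refine ENNReal.continuous_ofReal.comp ?_
    fun_prop
  have hseg : ∀ z ∈ Metric.ball (0 : EuclideanSpace ℝ (Fin n)) ε,
      1 ≤ ∫⁻ t in Set.Icc (0 : ℝ) 1, f (z + (a + t • (b - a))) := by
    intro z hz
    obtain ⟨t₀, ht₀, h1⟩ := hmeet z hz
    have hd : ∀ t : ℝ, HasDerivAt (fun t : ℝ => u (z + (a + t • (b - a))))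
        (fderiv ℝ u (z + (a + t • (b - a))) (b - a)) t := by
      intro t
      have hline : HasDerivAt (fun t : ℝ => z + (a + t • (b - a))) (b - a) t := by
        simpa using (((hasDerivAt_id t).smul_const (b - a)).const_add a).const_add z
      exact ((hu.differentiable one_ne_zero _).hasFDerivAt).comp_hasDerivAt t hline
    refine (one_le_lintegral_abs_add_abs_deriv hd (by fun_prop) ht₀ h1).trans ?_
    refine lintegral_mono fun t => ENNReal.ofReal_le_ofReal ?_
    rw [mul_comm]
    gcongr
    exact (fderiv ℝ u _).le_opNorm _
  calc volume (Metric.ball (0 : EuclideanSpace ℝ (Fin n)) ε)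
      = ∫⁻ _ in Metric.ball (0 : EuclideanSpace ℝ (Fin n)) ε, 1 := by simp
    _ ≤ ∫⁻ z in Metric.ball (0 : EuclideanSpace ℝ (Fin n)) ε, ∫⁻ t in Set.Icc (0 : ℝ) 1,
          f (z + (a + t • (b - a))) := setLIntegral_mono' measurableSet_ball hseg
    _ = ∫⁻ t in Set.Icc (0 : ℝ) 1, ∫⁻ z in Metric.ball (0 : EuclideanSpace ℝ (Fin n)) ε,
          f (z + (a + t • (b - a))) := by
        refine lintegral_lintegral_swap (Measurable.aemeasurable ?_)
        refine (hfc.comp ?_).measurable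
        fun_prop
    _ ≤ ∫⁻ _ in Set.Icc (0 : ℝ) 1, ∫⁻ x in S, f x := by
        refine setLIntegral_mono' measurableSet_Icc fun t ht => ?_
        rw [← lintegral_indicator hS,
          ← lintegral_add_right_eq_self (μ := volume) (S.indicator f) (a + t • (b - a))]
        refine le_trans ?_ (setLIntegral_le_lintegral (Metric.ball 0 ε) _)
        refine setLIntegral_mono' measurableSet_ball fun z hz => ?_
        rw [Set.indicator_of_mem (hsub z hz t ht)]
    _ = ∫⁻ x in S, f x := by simp

lemma le_add_rpow_mul_rpow {s δ q pp : ℝ} (hs : 0 ≤ s) (hδ : 0 < δ) (hδ1 : δ ≤ 1) (hq : 1 ≤ q)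
    (hqp : q ≤ pp) : s ≤ δ + δ ^ (1 - pp) * s ^ q := by
  rcases le_total s δ with h | h
  · have : 0 ≤ δ ^ (1 - pp) * s ^ q := by positivity
    linarith
  · have hs0 : 0 < s := hδ.trans_le h
    calc s = s ^ (1 - q) * s ^ q := by
          rw [← Real.rpow_add hs0]
          simp
      _ ≤ δ ^ (1 - pp) * s ^ q := by
          gcongr
          exact (Real.rpow_le_rpow_of_nonpos hδ h (by linarith)).trans
            (Real.rpow_le_rpow_of_exponent_ge hδ hδ1 (by linarith))
      _ ≤ δ + δ ^ (1 - pp) * s ^ q := by linarith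

lemma exists_lintegral_lt_of_pCapacity_eq_zero {n : ℕ} {p : EuclideanSpace ℝ (Fin n) → ℝ}
    {F : Set (EuclideanSpace ℝ (Fin n))} (hcap : pCapacity p F = 0) {η : ℝ≥0∞} (hη : 0 < η) :
    ∃ u : EuclideanSpace ℝ (Fin n) → ℝ, ContDiff ℝ 1 u ∧ (∀ x ∈ F, 1 ≤ u x) ∧
      ∫⁻ x, ENNReal.ofReal (|u x| ^ p x + ‖fderiv ℝ u x‖ ^ p x) < η := by
  rw [← hcap, pCapacity] at hη
  simp only [iInf_lt_iff] at hη
  obtain ⟨u, ⟨hu, U, -, hFU, hU⟩, hlt⟩ := hη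
  exact ⟨u, hu.of_le (by exact_mod_cast le_top), fun x hx => hU x (hFU hx), hlt⟩

/-- A set of zero capacity contains no nonempty open set. -/
lemma eq_empty_of_isOpen_of_pCapacity_eq_zero {n : ℕ} {p : EuclideanSpace ℝ (Fin n) → ℝ}
    (hp : ∀ x, 0 ≤ p x) {F O : Set (EuclideanSpace ℝ (Fin n))} (hcap : pCapacity p F = 0)
    (hO : IsOpen O) (hOF : O ⊆ F) : O = ∅ := by
  rw [← hO.measure_eq_zero_iff (volume : Measure (EuclideanSpace ℝ (Fin n)))]
  by_contra hne
  obtain ⟨u, -, h1, hlt⟩ := exists_lintegral_lt_of_pCapacity_eq_zero hcap (pos_iff_ne_zero.2 hne)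
  refine hlt.not_ge ?_
  calc volume O = ∫⁻ _ in O, 1 := by simp
    _ ≤ ∫⁻ x in O, ENNReal.ofReal (|u x| ^ p x + ‖fderiv ℝ u x‖ ^ p x) := by
        refine setLIntegral_mono' hO.measurableSet fun x hx => ?_
        rw [ENNReal.one_le_ofReal]
        have := Real.one_le_rpow ((h1 x (hOF hx)).trans (le_abs_self _)) (hp x)
        have : 0 ≤ ‖fderiv ℝ u x‖ ^ p x := by positivity
        linarith
    _ ≤ _ := setLIntegral_le_lintegral _ _

/-- In a set of finite measure, translates of a segment by a ball of vectors cannot all meet a set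
of zero capacity. -/
lemma not_forall_segment_meets_of_pCapacity_eq_zero {n : ℕ}
    {p : EuclideanSpace ℝ (Fin n) → ℝ} {pp : ℝ} (hp : ∀ x, 1 ≤ p x ∧ p x ≤ pp)
    {F S : Set (EuclideanSpace ℝ (Fin n))} (hcap : pCapacity p F = 0) (hS : MeasurableSet S)
    (hSfin : volume S ≠ ∞) {a b : EuclideanSpace ℝ (Fin n)} {ε : ℝ} (hε : 0 < ε)
    (hsub : ∀ z ∈ Metric.ball (0 : EuclideanSpace ℝ (Fin n)) ε, ∀ t ∈ Set.Icc (0 : ℝ) 1,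
      z + (a + t • (b - a)) ∈ S) :
    ¬ ∀ z ∈ Metric.ball (0 : EuclideanSpace ℝ (Fin n)) ε, ∃ t ∈ Set.Icc (0 : ℝ) 1,
      z + (a + t • (b - a)) ∈ F := by
  intro hmeet
  set C : ℝ := 1 + ‖b - a‖ with hC
  have hC0 : 0 ≤ ‖b - a‖ := norm_nonneg _
  have bound : ∀ δ : ℝ, 0 < δ → δ ≤ 1 → ∀ η : ℝ≥0∞, 0 < η →
      volume (Metric.ball (0 : EuclideanSpace ℝ (Fin n)) ε) ≤
        ENNReal.ofReal (C * δ) * volume S + ENNReal.ofReal (C * δ ^ (1 - pp)) * η := by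
    intro δ hδ hδ1 η hη
    obtain ⟨u, hu, h1, hlt⟩ := exists_lintegral_lt_of_pCapacity_eq_zero hcap hη
    refine (volume_ball_le_setLIntegral hu hS hsub fun z hz => ?_).trans ?_
    · obtain ⟨t, ht, htF⟩ := hmeet z hz
      exact ⟨t, ht, h1 _ htF⟩
    calc ∫⁻ x in S, ENNReal.ofReal (|u x| + ‖b - a‖ * ‖fderiv ℝ u x‖)
        ≤ ∫⁻ x in S, (ENNReal.ofReal (C * δ) + ENNReal.ofReal (C * δ ^ (1 - pp)) *
            ENNReal.ofReal (|u x| ^ p x + ‖fderiv ℝ u x‖ ^ p x)) := by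
          refine lintegral_mono fun x => ?_
          rw [← ENNReal.ofReal_mul (by positivity), ← ENNReal.ofReal_add (by positivity)
            (by positivity)]
          refine ENNReal.ofReal_le_ofReal ?_
          have e1 := le_add_rpow_mul_rpow (abs_nonneg (u x)) hδ hδ1 (hp x).1 (hp x).2
          have e2 := le_add_rpow_mul_rpow (norm_nonneg (fderiv ℝ u x)) hδ hδ1 (hp x).1 (hp x).2
          have e3 : 0 ≤ δ ^ (1 - pp) * |u x| ^ p x := by positivity
          have e4 : 0 ≤ δ ^ (1 - pp) * ‖fderiv ℝ u x‖ ^ p x := by positivity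
          rw [hC]
          nlinarith [mul_le_mul_of_nonneg_left e2 hC0, mul_nonneg hC0 e3]
      _ = ENNReal.ofReal (C * δ) * volume S + ENNReal.ofReal (C * δ ^ (1 - pp)) *
            ∫⁻ x in S, ENNReal.ofReal (|u x| ^ p x + ‖fderiv ℝ u x‖ ^ p x) := by
          rw [lintegral_add_left measurable_const, setLIntegral_const,
            lintegral_const_mul' _ _ ENNReal.ofReal_ne_top]
      _ ≤ _ := by
          gcongr
          exact (setLIntegral_le_lintegral _ _).trans hlt.le
  have bound' : ∀ δ : ℝ, 0 < δ → δ ≤ 1 →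
      volume (Metric.ball (0 : EuclideanSpace ℝ (Fin n)) ε) ≤
        ENNReal.ofReal (C * δ) * volume S := by
    intro δ hδ hδ1
    have hlim : Tendsto (fun η : ℝ≥0∞ => ENNReal.ofReal (C * δ) * volume S +
        ENNReal.ofReal (C * δ ^ (1 - pp)) * η) (𝓝[>] 0)
        (𝓝 (ENNReal.ofReal (C * δ) * volume S + ENNReal.ofReal (C * δ ^ (1 - pp)) * 0)) :=
      (tendsto_const_nhds.add (ENNReal.Tendsto.const_mul tendsto_id
        (Or.inr ENNReal.ofReal_ne_top))).mono_left nhdsWithin_le_nhds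
    rw [mul_zero, add_zero] at hlim
    exact ge_of_tendsto hlim (eventually_mem_nhdsWithin.mono fun η hη => bound δ hδ hδ1 η hη)
  have hlim : Tendsto (fun δ : ℝ => ENNReal.ofReal (C * δ) * volume S) (𝓝[>] 0)
      (𝓝 (ENNReal.ofReal (C * 0) * volume S)) :=
    (ENNReal.Tendsto.mul_const (ENNReal.tendsto_ofReal (tendsto_id.const_mul C))
      (Or.inr hSfin)).mono_left nhdsWithin_le_nhds
  rw [mul_zero, ENNReal.ofReal_zero, zero_mul] at hlim
  have hle := ge_of_tendsto hlim (b := volume (Metric.ball (0 : EuclideanSpace ℝ (Fin n)) ε)) <| by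
    filter_upwards [Ioo_mem_nhdsGT (zero_lt_one' ℝ)] with δ hδ using bound' δ hδ.1 hδ.2.le
  exact (Metric.measure_ball_pos volume _ hε).not_ge hle

/-- If `G` is open and connected and `F ⊆ G` is relatively closed in `G` with
`C_{p(·)}(F) = 0`, then `G \ F` is connected. -/
theorem connected_diff_of_capacity_zero
    {n : ℕ}
    (p : EuclideanSpace ℝ (Fin n) → ℝ) (hpmeas : Measurable p)
    (pm pp : ℝ) (hpm : 1 < pm) (hbd : ∀ x, pm ≤ p x ∧ p x ≤ pp)
    (hlog : LogHolder p)
    (G F : Set (EuclideanSpace ℝ (Fin n)))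
    (hGopen : IsOpen G) (hGconn : IsConnected G)
    (hFG : F ⊆ G)
    (hFclosed : IsClosed (Subtype.val ⁻¹' F : Set G))
    (hcap : pCapacity p F = 0) :
    IsConnected (G \ F) := by
  have hp : ∀ x, 1 ≤ p x ∧ p x ≤ pp := fun x => ⟨hpm.le.trans (hbd x).1, (hbd x).2⟩
  have hnoOpen : ∀ O, IsOpen O → O ⊆ F → O = ∅ := fun O =>
    eq_empty_of_isOpen_of_pCapacity_eq_zero (fun x => zero_le_one.trans (hp x).1) hcap
  have hopen : IsOpen (G \ F) := by
    have := hGopen.isOpenMap_subtype_val _ hFclosed.isOpen_compl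
    rwa [← Set.preimage_compl, Subtype.image_preimage_coe, ← Set.sdiff_eq] at this
  refine ⟨?_, ?_⟩
  · by_contra hne
    rw [Set.not_nonempty_iff_eq_empty, Set.sdiff_eq_empty] at hne
    exact hGconn.nonempty.ne_empty (hnoOpen G hGopen hne)
  intro U V hU hV hUV hneU hneV
  by_contra hdisj
  have hcover : G ⊆ closure ((G \ F) ∩ U) ∪ closure ((G \ F) ∩ V) := by
    intro y hy
    rw [← closure_union, ← Set.inter_union_distrib_left, Set.inter_eq_left.2 hUV,
      mem_closure_iff]
    intro O hO hyO
    by_contra hemp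
    have hOF : O ∩ G ⊆ F := fun w hw => by
      by_contra hwF
      exact hemp ⟨w, hw.1, hw.2, hwF⟩
    exact (hnoOpen _ (hO.inter hGopen) hOF).subset ⟨hyO, hy⟩
  have hmeet : ∀ {A : Set (EuclideanSpace ℝ (Fin n))}, ((G \ F) ∩ A).Nonempty →
      (G ∩ closure ((G \ F) ∩ A)).Nonempty :=
    fun ⟨w, hw⟩ => ⟨w, hw.1.1, subset_closure hw⟩
  obtain ⟨x, hxG, hxU, hxV⟩ := isPreconnected_closed_iff.1 hGconn.isPreconnected _ _
    isClosed_closure isClosed_closure hcover (hmeet hneU) (hmeet hneV)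
  obtain ⟨r, hr, hrG⟩ := Metric.isOpen_iff.1 hGopen x hxG
  obtain ⟨a, har, haU⟩ := mem_closure_iff.1 hxU _ Metric.isOpen_ball (Metric.mem_ball_self hr)
  obtain ⟨b, hbr, hbV⟩ := mem_closure_iff.1 hxV _ Metric.isOpen_ball (Metric.mem_ball_self hr)
  obtain ⟨ε₁, hε₁, ha⟩ := Metric.isOpen_iff.1
    (Metric.isOpen_ball.inter (hopen.inter hU)) a ⟨har, haU⟩
  obtain ⟨ε₂, hε₂, hb⟩ := Metric.isOpen_iff.1
    (Metric.isOpen_ball.inter (hopen.inter hV)) b ⟨hbr, hbV⟩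
  have hza : ∀ z ∈ Metric.ball (0 : EuclideanSpace ℝ (Fin n)) (min ε₁ ε₂),
      z + a ∈ Metric.ball x r ∩ ((G \ F) ∩ U) := fun z hz => ha <| by
    rw [mem_ball_zero_iff, lt_min_iff] at hz
    simpa [dist_eq_norm] using hz.1
  have hzb : ∀ z ∈ Metric.ball (0 : EuclideanSpace ℝ (Fin n)) (min ε₁ ε₂),
      z + b ∈ Metric.ball x r ∩ ((G \ F) ∩ V) := fun z hz => hb <| by
    rw [mem_ball_zero_iff, lt_min_iff] at hz
    simpa [dist_eq_norm] using hz.2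
  have hseg : ∀ z : EuclideanSpace ℝ (Fin n), segment ℝ (z + a) (z + b) =
      (fun t : ℝ => z + (a + t • (b - a))) '' Set.Icc (0 : ℝ) 1 := by
    intro z
    rw [segment_eq_image']
    simp only [add_sub_add_left_eq_sub, add_assoc]
  have hsegball : ∀ z ∈ Metric.ball (0 : EuclideanSpace ℝ (Fin n)) (min ε₁ ε₂),
      segment ℝ (z + a) (z + b) ⊆ Metric.ball x r := fun z hz =>
    (convex_ball x r).segment_subset (hza z hz).1 (hzb z hz).1
  refine not_forall_segment_meets_of_pCapacity_eq_zero hp hcap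
    (Metric.isOpen_ball (x := x) (ε := r)).measurableSet measure_ball_lt_top.ne
    (lt_min hε₁ hε₂) (a := a) (b := b) (fun z hz t ht => ?_) fun z hz => ?_
  · exact hsegball z hz (hseg z ▸ Set.mem_image_of_mem _ ht)
  · by_contra! hmiss
    have hsub : segment ℝ (z + a) (z + b) ⊆ G \ F := by
      intro w hw
      refine ⟨hrG (hsegball z hz hw), ?_⟩
      rw [hseg] at hw
      obtain ⟨t, ht, rfl⟩ := hw
      exact hmiss t ht
    obtain ⟨w, hw, hwUV⟩ := (convex_segment (z + a) (z + b)).isPreconnected U V hU hV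
      (hsub.trans hUV) ⟨_, left_mem_segment ℝ _ _, (hza z hz).2.2⟩
      ⟨_, right_mem_segment ℝ _ _, (hzb z hz).2.2⟩
    exact hdisj ⟨w, hsub hw, hwUV⟩
end

section
/- Let X be a topological space, let G ⊆ X be open and connected, and let F ⊆ G be relatively closed in G (i.e. closed in the subspace topology of G) with F ≠ G. If G ∖ (∂F ∩ G) is connected, where ∂F denotes the topological boundary (frontier) of F in X, then F has empty interior and F = ∂F ∩ G. -/
open Topology

/-- Let `G ⊆ X` be open and connected and let `F ⊆ G` be relatively closed in `G` with
`F ≠ G`. If `G \ (∂F ∩ G)` is connected, then `F` has empty interior and `F = ∂F ∩ G`. -/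
theorem interior_empty_and_eq_frontier_inter_of_connected
    {X : Type*} [TopologicalSpace X]
    (G F : Set X) (hGopen : IsOpen G) (hGconn : IsConnected G)
    (hFG : F ⊆ G) (hFclosed : IsClosed (Subtype.val ⁻¹' F : Set G))
    (hFne : F ≠ G)
    (hconn : IsConnected (G \ (frontier F ∩ G))) :
    interior F = ∅ ∧ F = frontier F ∩ G := by
  have hcl : closure F ∩ G ⊆ F := by
    obtain ⟨C, hC, hCF⟩ := isClosed_induced_iff.1 hFclosed
    rintro x ⟨hx, hxG⟩
    have hFC : F ⊆ C := fun y hy => by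
      have h : (⟨y, hFG hy⟩ : G) ∈ (Subtype.val ⁻¹' F : Set G) := hy
      rwa [← hCF] at h
    have h : (⟨x, hxG⟩ : G) ∈ (Subtype.val ⁻¹' C : Set G) := closure_minimal hFC hC hx
    rwa [hCF] at h
  have hint : interior F = ∅ := by
    by_contra hne
    obtain ⟨x, hx⟩ := Set.nonempty_iff_ne_empty.2 hne
    obtain ⟨y, hyG, hyF⟩ := Set.exists_of_ssubset (hFG.ssubset_of_ne hFne)
    have hyc : y ∉ closure F := fun h => hyF (hcl ⟨h, hyG⟩)
    obtain ⟨z, -, hz, hzc⟩ := hconn.isPreconnected (interior F) (closure F)ᶜ isOpen_interior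
      isClosed_closure.isOpen_compl
      (fun w hw => by
        by_cases hwi : w ∈ interior F
        · exact Or.inl hwi
        · exact Or.inr fun hwc => hw.2 ⟨⟨hwc, hwi⟩, hw.1⟩)
      ⟨x, ⟨hFG (interior_subset hx), fun h => h.1.2 hx⟩, hx⟩
      ⟨y, ⟨hyG, fun h => hyc h.1.1⟩, hyc⟩
    exact hzc (subset_closure (interior_subset hz))
  refine ⟨hint, ?_⟩
  rw [frontier, hint, Set.sdiff_empty]
  exact (Set.subset_inter subset_closure hFG).antisymm hcl
end

section
/- Let X be a topological space, let Ω ⊆ X be open, and let G ⊆ X be open and connected with G ∩ Ω ≠ ∅. If G ∖ ∂Ω is connected, where ∂Ω denotes the topological boundary (frontier) of Ω in X, then G is contained in the closure of Ω; consequently, if moreover G ∩ ∂Ω ⊆ V for some set V, then G ⊆ Ω ∪ V. -/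
open Topology

/-- Let `Ω ⊆ X` be open and `G ⊆ X` be open and connected with `G ∩ Ω ≠ ∅`.
If `G \ ∂Ω` is connected, then `G ⊆ closure Ω`; consequently, if moreover
`G ∩ ∂Ω ⊆ V`, then `G ⊆ Ω ∪ V`. -/
theorem subset_closure_and_subset_union_of_connected_diff_frontier
    {X : Type*} [TopologicalSpace X]
    (Ω G : Set X) (hΩopen : IsOpen Ω)
    (hGopen : IsOpen G) (hGconn : IsConnected G)
    (hne : (G ∩ Ω).Nonempty)
    (hconn : IsConnected (G \ frontier Ω)) :
    G ⊆ closure Ω ∧ ∀ V : Set X, G ∩ frontier Ω ⊆ V → G ⊆ Ω ∪ V := by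
  have hcover : G \ frontier Ω ⊆ Ω ∪ (closure Ω)ᶜ := fun x hx => by
    by_cases hxc : x ∈ closure Ω
    · exact Or.inl (by_contra fun hxΩ => hx.2 (hΩopen.frontier_eq ▸ ⟨hxc, hxΩ⟩))
    · exact Or.inr hxc
  have hmeet : ((G \ frontier Ω) ∩ Ω).Nonempty := by
    obtain ⟨x, hxG, hxΩ⟩ := hne
    exact ⟨x, ⟨hxG, fun hx => (hΩopen.frontier_eq ▸ hx).2 hxΩ⟩, hxΩ⟩
  have hdiff : G \ frontier Ω ⊆ Ω :=
    hconn.isPreconnected.subset_left_of_subset_union hΩopen isClosed_closure.isOpen_compl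
      (Set.disjoint_compl_right_iff_subset.2 subset_closure) hcover hmeet
  refine ⟨fun x hx => ?_, fun V hV x hx => ?_⟩ <;> by_cases hxf : x ∈ frontier Ω
  · exact frontier_subset_closure hxf
  · exact subset_closure (hdiff ⟨hx, hxf⟩)
  · exact Or.inr (hV ⟨hx, hxf⟩)
  · exact Or.inl (hdiff ⟨hx, hxf⟩)
end

section
/- Let Ω ⊆ ℝⁿ be open and let p : Ω → ℝ be measurable with 1 < p⁻ ≤ p(x) ≤ p⁺ < ∞ for a.e. x ∈ Ω. Let u : Ω → ℝ be locally Lipschitz, bounded, with u ≤ 0 in Ω, and let ∇u denote its almost-everywhere defined gradient (which exists a.e. by Rademacher's theorem). Assume that ∫_Ω p(x)|∇u(x)|^{p(x)−2} ∇u(x)·∇ψ(x) dx ≥ 0 for every nonnegative Lipschitz function ψ : Ω → ℝ with compact support contained in Ω. Then there is a constant C depending only on p⁺ such that for every smooth function η : ℝⁿ → [0,1] with compact support contained in Ω, ∫_Ω |∇u(x)|^{p(x)} η(x)^{p⁺} dx ≤ C ∫_Ω |u(x)|^{p(x)} |∇η(x)|^{p(x)} dx. -/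
open MeasureTheory Filter Topology
open scoped ENNReal NNReal RealInnerProductSpace

/-- The product of a bounded locally Lipschitz function with a compactly supported Lipschitz
function is Lipschitz. -/
lemma exists_lipschitzWith_mul_of_hasCompactSupport {E : Type*} [NormedAddCommGroup E]
    [NormedSpace ℝ E] [FiniteDimensional ℝ E] {Ω : Set E} (hΩ : IsOpen Ω) {u g : E → ℝ}
    (hu : LocallyLipschitzOn Ω u) {M : ℝ} (hM : ∀ x ∈ Ω, |u x| ≤ M) {L : ℝ≥0}
    (hg : LipschitzWith L g) (hg1 : ∀ x, |g x| ≤ 1) (hgc : HasCompactSupport g)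
    (hgs : tsupport g ⊆ Ω) : ∃ K : ℝ≥0, LipschitzWith K fun x => u x * g x := by
  have : ProperSpace E := FiniteDimensional.proper ℝ E
  obtain ⟨δ, hδ, hT⟩ := hgc.isCompact.exists_cthickening_subset_open hΩ hgs
  have hTc : IsCompact (Metric.cthickening δ (tsupport g)) := hgc.isCompact.cthickening
  obtain ⟨K, hK⟩ := (hu.mono hT).exists_lipschitzOnWith_of_compact hTc
  have hzero : ∀ x, x ∉ tsupport g → g x = 0 := fun x hx => image_eq_zero_of_notMem_tsupport hx
  set N : ℝ := max M 0
  have hN0 : 0 ≤ N := le_max_right _ _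
  have hN : ∀ x ∈ Ω, |u x| ≤ N := fun x hx => (hM x hx).trans (le_max_left _ _)
  set R : ℝ := K + N * L + N / δ
  have hKL : 0 ≤ (K : ℝ) + N * L := by positivity
  have hNδ : 0 ≤ N / δ := by positivity
  have key : ∀ x y, x ∈ tsupport g → |u x * g x - u y * g y| ≤ R * dist x y := by
    intro x y hx
    have hd : 0 ≤ dist x y := dist_nonneg
    by_cases hy : y ∈ Metric.cthickening δ (tsupport g)
    · have h1 := hK.dist_le_mul x (Metric.self_subset_cthickening _ hx) y hy
      have h2 := hg.dist_le_mul x y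
      rw [Real.dist_eq] at h1 h2
      have h3 : |u x * g x - u y * g y| ≤ |u x - u y| * |g x| + |u y| * |g x - g y| := by
        rw [← abs_mul, ← abs_mul]
        refine le_trans (le_of_eq ?_) (abs_add_le _ _)
        congr 1
        ring
      have h4 : |u x - u y| * |g x| ≤ (K * dist x y) * 1 :=
        mul_le_mul h1 (hg1 x) (abs_nonneg _) (by positivity)
      have h5 : |u y| * |g x - g y| ≤ N * (L * dist x y) :=
        mul_le_mul (hN y (hT hy)) h2 (abs_nonneg _) hN0
      have h6 : 0 ≤ N / δ * dist x y := by positivity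
      simp only [R]
      nlinarith
    · have hy' : y ∉ tsupport g := fun h => hy (Metric.self_subset_cthickening _ h)
      have hdist : δ ≤ dist x y := by
        by_contra! hlt
        exact hy (Metric.mem_cthickening_of_dist_le y x δ _ hx (by rw [dist_comm]; exact hlt.le))
      rw [hzero y hy', mul_zero, sub_zero, abs_mul]
      have h1 : |u x| * |g x| ≤ N * 1 := mul_le_mul (hN x (hgs hx)) (hg1 x) (abs_nonneg _) hN0
      have h2 : N ≤ N / δ * dist x y := by
        rw [div_mul_eq_mul_div, le_div_iff₀ hδ]
        gcongr
      have h3 : 0 ≤ ((K : ℝ) + N * L) * dist x y := by positivity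
      simp only [R]
      nlinarith
  refine ⟨R.toNNReal, LipschitzWith.of_dist_le_mul fun x y => ?_⟩
  rw [Real.coe_toNNReal _ (by positivity), Real.dist_eq]
  by_cases hx : x ∈ tsupport g
  · exact key x y hx
  by_cases hy : y ∈ tsupport g
  · rw [abs_sub_comm, dist_comm]
    exact key y x hy
  · rw [hzero x hx, hzero y hy]
    simp only [mul_zero, sub_zero, abs_zero]
    positivity

/-- Rademacher's theorem for a locally Lipschitz function on an open set. -/
lemma LocallyLipschitzOn.ae_differentiableAt {E : Type*} [NormedAddCommGroup E]
    [NormedSpace ℝ E] [FiniteDimensional ℝ E] [MeasurableSpace E] [BorelSpace E]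
    {μ : Measure E} [μ.IsAddHaarMeasure] {Ω : Set E} (hΩ : IsOpen Ω) {u : E → ℝ}
    (hu : LocallyLipschitzOn Ω u) : ∀ᵐ x ∂(μ.restrict Ω), DifferentiableAt ℝ u x := by
  have : ProperSpace E := FiniteDimensional.proper ℝ E
  rw [ae_restrict_iff' hΩ.measurableSet, ae_iff]
  refine measure_null_of_locally_null _ fun x hx => ?_
  have hxΩ : x ∈ Ω := by
    by_contra h
    exact hx fun h' => absurd h' h
  obtain ⟨K, t, ht, hK⟩ := hu hxΩ
  rw [hΩ.nhdsWithin_eq hxΩ] at ht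
  refine ⟨interior t ∩ {y | ¬(y ∈ Ω → DifferentiableAt ℝ u y)},
    Filter.inter_mem (mem_nhdsWithin_of_mem_nhds (interior_mem_nhds.2 ht)) self_mem_nhdsWithin, ?_⟩
  have hae := (hK.mono interior_subset).ae_differentiableWithinAt_of_mem (μ := μ)
  refine measure_mono_null ?_ (ae_iff.1 hae)
  rintro y ⟨hy, hy'⟩ h
  exact hy' fun _ => (h hy).differentiableAt (isOpen_interior.mem_nhds hy)

/-- The gradient of a locally Lipschitz function is bounded on compact sets. -/
lemma LocallyLipschitzOn.exists_norm_gradient_le {E : Type*} [NormedAddCommGroup E]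
    [InnerProductSpace ℝ E] [CompleteSpace E] {Ω s : Set E} (hΩ : IsOpen Ω) {u : E → ℝ}
    (hu : LocallyLipschitzOn Ω u) (hs : IsCompact s) (hsΩ : s ⊆ Ω) :
    ∃ G : ℝ, ∀ x ∈ s, ‖gradient u x‖ ≤ G := by
  refine hs.induction_on (p := fun s => ∃ G : ℝ, ∀ x ∈ s, ‖gradient u x‖ ≤ G) ⟨0, by simp⟩
    (fun s t hst ⟨G, hG⟩ => ⟨G, fun x hx => hG x (hst hx)⟩) ?_ ?_
  · rintro s t ⟨G, hG⟩ ⟨H, hH⟩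
    refine ⟨max G H, ?_⟩
    rintro x (hx | hx)
    · exact (hG x hx).trans (le_max_left _ _)
    · exact (hH x hx).trans (le_max_right _ _)
  · intro x hx
    obtain ⟨K, t, ht, hK⟩ := hu (hsΩ hx)
    rw [hΩ.nhdsWithin_eq (hsΩ hx)] at ht
    refine ⟨interior t, mem_nhdsWithin_of_mem_nhds (interior_mem_nhds.2 ht), K, fun y hy => ?_⟩
    rw [gradient, LinearIsometryEquiv.norm_map]
    exact norm_fderiv_le_of_lipschitzOn ℝ (mem_interior_iff_mem_nhds.1 hy) hK

lemma measurable_gradient {E : Type*} [NormedAddCommGroup E] [InnerProductSpace ℝ E]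
    [CompleteSpace E] [MeasurableSpace E] [BorelSpace E] (f : E → ℝ) :
    Measurable (gradient f) := by
  borelize (StrongDual ℝ E)
  exact (InnerProductSpace.toDual ℝ E).symm.continuous.measurable.comp (measurable_fderiv ℝ f)

lemma integrableOn_of_bounded_of_eq_zero {E : Type*} [TopologicalSpace E] [T2Space E]
    [MeasurableSpace E] [OpensMeasurableSpace E] {μ : Measure E} [IsFiniteMeasureOnCompacts μ]
    {Ω s : Set E} (hs : IsCompact s) {f : E → ℝ}
    (hf : AEStronglyMeasurable f (μ.restrict Ω)) (h0 : ∀ᵐ x ∂(μ.restrict Ω), x ∉ s → f x = 0) {C : ℝ}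
    (hC : ∀ᵐ x ∂(μ.restrict Ω), x ∈ s → |f x| ≤ C) : IntegrableOn f Ω μ := by
  have hint : Integrable (s.indicator fun _ => C) (μ.restrict Ω) := by
    have h : Integrable (s.indicator fun _ => C) μ := by
      rw [integrable_indicator_iff hs.measurableSet]
      exact integrableOn_const hs.measure_lt_top.ne
    exact h.restrict
  refine Integrable.mono' hint hf ?_
  filter_upwards [hC, h0] with x hx hx0
  by_cases h : x ∈ s
  · simpa [h] using hx h
  · simp [h, hx0 h]

lemma rpow_le_max_one_rpow {x G r P : ℝ} (hx : 0 ≤ x) (hxG : x ≤ G) (hr : 0 ≤ r) (hrP : r ≤ P) :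
    x ^ r ≤ max G 1 ^ P :=
  (Real.rpow_le_rpow hx (hxG.trans (le_max_left _ _)) hr).trans
    (Real.rpow_le_rpow_of_exponent_le (le_max_right _ _) hrP)

/-- Young's inequality in the form that absorbs the cross term of the Caccioppoli estimate. -/
lemma mul_rpow_cross_term_le {p P g e w d : ℝ} (hp : 1 < p) (hpP : p ≤ P) (hg : 0 ≤ g)
    (he : 0 ≤ e) (he1 : e ≤ 1) (hw : 0 ≤ w) (hd : 0 ≤ d) :
    p * (g ^ (p - 1) * e ^ (P - 1) * (P * w * d)) ≤
      (p - 1) * (g ^ p * e ^ P) + P ^ P * (w ^ p * d ^ p) := by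
  have hp0 : 0 < p := by linarith
  have hp1 : 0 < p - 1 := by linarith
  have hP0 : 0 < P := by linarith
  have hconj : (p / (p - 1)).HolderConjugate p := (Real.HolderConjugate.conjExponent hp).symm
  have hyoung := Real.young_inequality_of_nonneg
    (a := g ^ (p - 1) * e ^ (P - 1)) (b := P * w * d) (by positivity) (by positivity) hconj
  have ha : (g ^ (p - 1) * e ^ (P - 1)) ^ (p / (p - 1)) ≤ g ^ p * e ^ P := by
    rw [Real.mul_rpow (by positivity) (by positivity), ← Real.rpow_mul hg, ← Real.rpow_mul he,
      mul_div_cancel₀ p hp1.ne']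
    refine mul_le_mul_of_nonneg_left ?_ (by positivity)
    refine Real.rpow_le_rpow_of_exponent_ge' he he1 hP0.le ?_
    rw [mul_div_assoc', le_div_iff₀ hp1]
    nlinarith
  have hb : (P * w * d) ^ p ≤ P ^ P * (w ^ p * d ^ p) := by
    rw [Real.mul_rpow (by positivity) hd, Real.mul_rpow hP0.le hw, mul_assoc]
    gcongr
    linarith
  calc p * (g ^ (p - 1) * e ^ (P - 1) * (P * w * d))
      ≤ p * ((g ^ (p - 1) * e ^ (P - 1)) ^ (p / (p - 1)) / (p / (p - 1))
          + (P * w * d) ^ p / p) := by gcongr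
    _ = (p - 1) * (g ^ (p - 1) * e ^ (P - 1)) ^ (p / (p - 1)) + (P * w * d) ^ p := by
        field_simp
    _ ≤ _ := by gcongr

/-- Pointwise form of the Caccioppoli estimate, with `a = ∇u`, `b = ∇η`, `w = -u`, `e = η`. -/
lemma caccioppoli_pointwise {E : Type*} [NormedAddCommGroup E] [InnerProductSpace ℝ E]
    {p P e w : ℝ} (a b : E) (hp : 1 < p) (hpP : p ≤ P) (he : 0 ≤ e) (he1 : e ≤ 1) (hw : 0 ≤ w) :
    p * ‖a‖ ^ (p - 2) * ⟪a, (w * (P * e ^ (P - 1))) • b - e ^ P • a⟫ ≤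
      P ^ P * (w ^ p * ‖b‖ ^ p) - ‖a‖ ^ p * e ^ P := by
  have hP0 : 0 < P := by linarith
  rcases eq_or_ne a 0 with rfl | ha
  · simp only [inner_zero_left, mul_zero, norm_zero, Real.zero_rpow (by linarith : p ≠ 0),
      zero_mul, sub_zero]
    positivity
  have hna : 0 < ‖a‖ := norm_pos_iff.2 ha
  have h2 : ‖a‖ ^ (p - 2) * ‖a‖ ^ 2 = ‖a‖ ^ p := by
    rw [← Real.rpow_natCast, ← Real.rpow_add hna]
    norm_num
  have h1 : ‖a‖ ^ (p - 2) * ‖a‖ = ‖a‖ ^ (p - 1) := by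
    rw [← Real.rpow_add_one hna.ne']
    ring_nf
  have hcs : ⟪a, b⟫ ≤ ‖a‖ * ‖b‖ := real_inner_le_norm a b
  have hcross := mul_rpow_cross_term_le hp hpP hna.le he he1 hw (norm_nonneg b)
  rw [inner_sub_right, inner_smul_right, inner_smul_right, real_inner_self_eq_norm_sq]
  have hle : p * ‖a‖ ^ (p - 2) * (w * (P * e ^ (P - 1)) * ⟪a, b⟫) ≤
      p * ‖a‖ ^ (p - 2) * (w * (P * e ^ (P - 1)) * (‖a‖ * ‖b‖)) := by gcongr
  have e1 : p * ‖a‖ ^ (p - 2) * (w * (P * e ^ (P - 1)) * (‖a‖ * ‖b‖)) =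
      p * (‖a‖ ^ (p - 1) * e ^ (P - 1) * (P * w * ‖b‖)) := by
    rw [← h1]; ring
  have e2 : p * ‖a‖ ^ (p - 2) * (e ^ P * ‖a‖ ^ 2) = p * (‖a‖ ^ p * e ^ P) := by
    rw [← h2]; ring
  rw [mul_sub, e2]
  linarith

lemma hasGradientAt_neg_mul_rpow {E : Type*} [NormedAddCommGroup E] [InnerProductSpace ℝ E]
    [CompleteSpace E] {u η : E → ℝ} {x : E} {P : ℝ} (hP : 1 ≤ P) (hu : DifferentiableAt ℝ u x)
    (hη : DifferentiableAt ℝ η x) :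
    HasGradientAt (fun y => -u y * η y ^ P)
      ((-u x * (P * η x ^ (P - 1))) • gradient η x - η x ^ P • gradient u x) x := by
  rw [hasGradientAt_iff_hasFDerivAt]
  have h := hu.hasFDerivAt.neg.mul (hη.hasFDerivAt.rpow_const (p := P) (Or.inr hP))
  refine h.congr_fderiv ?_
  simp only [map_sub, map_smul, toDual_gradient]
  ext v
  simp
  ring

/-- Caccioppoli-type estimate: if `u ≤ 0` is a bounded locally Lipschitz function on `Ω`
satisfying the supersolution inequality
`∫_Ω p(x)|∇u|^{p(x)-2} ∇u·∇ψ dx ≥ 0` for all nonnegative Lipschitz `ψ` with compact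
support in `Ω`, then there is a constant `C` depending only on `p⁺` such that for every
smooth `η : ℝⁿ → [0,1]` with compact support in `Ω`,
`∫_Ω |∇u|^{p(x)} η^{p⁺} dx ≤ C ∫_Ω |u|^{p(x)} |∇η|^{p(x)} dx`. -/
theorem caccioppoli_variable_exponent (pp : ℝ) :
    ∃ C : ℝ, 0 < C ∧
      ∀ (pm : ℝ), 1 < pm → pm ≤ pp →
      ∀ (n : ℕ), 0 < n →
      ∀ (Ω : Set (EuclideanSpace ℝ (Fin n))), IsOpen Ω →
      ∀ (p : EuclideanSpace ℝ (Fin n) → ℝ), Measurable p →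
      (∀ᵐ x ∂(volume.restrict Ω), pm ≤ p x ∧ p x ≤ pp) →
      ∀ (u : EuclideanSpace ℝ (Fin n) → ℝ),
        -- u is locally Lipschitz in Ω
        (∀ x ∈ Ω, ∃ (K : ℝ≥0) (t : Set (EuclideanSpace ℝ (Fin n))),
            t ∈ nhdsWithin x Ω ∧ LipschitzOnWith K u t) →
        -- u is bounded
        (∃ M : ℝ, ∀ x ∈ Ω, |u x| ≤ M) →
        -- u ≤ 0 in Ω
        (∀ x ∈ Ω, u x ≤ 0) →
        -- the supersolution inequality for nonnegative compactly supported Lipschitz ψ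
        (∀ (ψ : EuclideanSpace ℝ (Fin n) → ℝ) (K : ℝ≥0),
            LipschitzWith K ψ → (∀ x, 0 ≤ ψ x) → HasCompactSupport ψ → tsupport ψ ⊆ Ω →
            0 ≤ ∫ x in Ω,
              p x * ‖gradient u x‖ ^ (p x - 2) * ⟪gradient u x, gradient ψ x⟫) →
        ∀ (η : EuclideanSpace ℝ (Fin n) → ℝ), ContDiff ℝ (⊤ : ℕ∞) η →
          (∀ x, η x ∈ Set.Icc (0 : ℝ) 1) → HasCompactSupport η → tsupport η ⊆ Ω →
          (∫⁻ x in Ω, ENNReal.ofReal (‖gradient u x‖ ^ p x * η x ^ pp)) ≤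
            ENNReal.ofReal C *
              ∫⁻ x in Ω, ENNReal.ofReal (|u x| ^ p x * ‖gradient η x‖ ^ p x) := by
  refine ⟨max 1 (pp ^ pp), lt_max_of_lt_left one_pos, ?_⟩
  intro pm hpm hpmpp n _ Ω hΩ p hp hpb u hu ⟨M, hM⟩ hu0 hsuper η hη hη01 hηc hηs
  have hpp : 1 < pp := hpm.trans_le hpmpp
  have hpp0 : 0 < pp := by linarith
  have huL : LocallyLipschitzOn Ω u := hu
  have hη1 : ContDiff ℝ 1 η := hη.of_le (by exact_mod_cast le_top)
  set ζ : EuclideanSpace ℝ (Fin n) → ℝ := fun x => η x ^ pp with hζ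
  have hζ1 : ContDiff ℝ 1 ζ := by
    simpa using hη1.rpow_const_of_le (m := 1) (p := pp) (by simpa using hpp.le)
  have hζ0 : ∀ x, η x = 0 → ζ x = 0 := fun x hx => by
    simp [hζ, hx, Real.zero_rpow hpp0.ne']
  have hζsupp : Function.support ζ ⊆ Function.support η := fun x hx h => hx (hζ0 x h)
  have hζs : tsupport ζ ⊆ tsupport η := closure_mono hζsupp
  have hζc : HasCompactSupport ζ := hηc.mono hζsupp
  have hζ01 : ∀ x, 0 ≤ ζ x ∧ ζ x ≤ 1 := fun x =>
    ⟨Real.rpow_nonneg (hη01 x).1 _, Real.rpow_le_one (hη01 x).1 (hη01 x).2 hpp0.le⟩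
  obtain ⟨L, hL⟩ := hζ1.lipschitzWith_of_hasCompactSupport hζc one_ne_zero
  obtain ⟨K, hK⟩ := exists_lipschitzWith_mul_of_hasCompactSupport hΩ huL hM hL
    (fun x => by rw [abs_of_nonneg (hζ01 x).1]; exact (hζ01 x).2) hζc (hζs.trans hηs)
  set ψ : EuclideanSpace ℝ (Fin n) → ℝ := fun x => -u x * ζ x with hψ
  have hψL : LipschitzWith K ψ := by
    have h : ψ = -fun x => u x * ζ x := funext fun x => neg_mul _ _
    rw [h]
    exact hK.neg
  have hψsupp : Function.support ψ ⊆ Function.support ζ := fun x hx h => hx (by simp [hψ, h])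
  have hψs : tsupport ψ ⊆ tsupport η := (closure_mono hψsupp).trans hζs
  have hψ0 : ∀ x, 0 ≤ ψ x := by
    intro x
    by_cases hx : x ∈ Ω
    · exact mul_nonneg (neg_nonneg.2 (hu0 x hx)) (hζ01 x).1
    · have : ζ x = 0 := image_eq_zero_of_notMem_tsupport fun h => hx (hηs (hζs h))
      simp [hψ, this]
  have hF0 := hsuper ψ K hψL hψ0 (hζc.mono hψsupp) (hψs.trans hηs)
  have hgrad0 : ∀ {f : EuclideanSpace ℝ (Fin n) → ℝ}, tsupport f ⊆ tsupport η →
      ∀ x, x ∉ tsupport η → gradient f x = 0 := by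
    intro f hf x hx
    have : f =ᶠ[𝓝 x] fun _ => 0 := notMem_tsupport_iff_eventuallyEq.1 fun h => hx (hf h)
    rw [this.gradient_eq, gradient_fun_const]
  obtain ⟨G, hG⟩ := huL.exists_norm_gradient_le hΩ hηc.isCompact hηs
  obtain ⟨D, hD⟩ := (hη1.locallyLipschitz.locallyLipschitzOn (s := Ω)).exists_norm_gradient_le
    hΩ hηc.isCompact hηs
  have hψG : ∀ x, ‖gradient ψ x‖ ≤ K := fun x => by
    rw [gradient, LinearIsometryEquiv.norm_map]
    exact norm_fderiv_le_of_lipschitz ℝ hψL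
  have hgu := measurable_gradient u
  have hgη := measurable_gradient η
  have hgψ := measurable_gradient ψ
  have hum : AEMeasurable u (volume.restrict Ω) := huL.continuousOn.aemeasurable hΩ.measurableSet
  have hηm : Measurable η := hη1.continuous.measurable
  have hFint : IntegrableOn (fun x => p x * ‖gradient u x‖ ^ (p x - 2) *
      ⟪gradient u x, gradient ψ x⟫) Ω volume := by
    refine integrableOn_of_bounded_of_eq_zero hηc.isCompact
      (C := pp * max G 1 ^ pp * K) ?_ ?_ ?_
    · exact ((hp.mul (hgu.norm.pow (hp.sub_const 2))).mul
        (hgu.inner hgψ)).aestronglyMeasurable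
    · refine ae_of_all _ fun x hx => ?_
      simp [hgrad0 hψs x hx]
    · filter_upwards [hpb] with x hpx hx
      have hp0 : 0 < p x := by linarith [hpx.1]
      rcases eq_or_ne (gradient u x) 0 with h0 | h0
      · simp only [h0, inner_zero_left, mul_zero, abs_zero]
        positivity
      have hpos : 0 < ‖gradient u x‖ := norm_pos_iff.2 h0
      have h1 : ‖gradient u x‖ ^ (p x - 2) * ‖gradient u x‖ = ‖gradient u x‖ ^ (p x - 1) := by
        rw [← Real.rpow_add_one hpos.ne']
        ring_nf
      have h2 : ‖gradient u x‖ ^ (p x - 1) ≤ max G 1 ^ pp :=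
        rpow_le_max_one_rpow hpos.le (hG x hx) (by linarith [hpx.1]) (by linarith [hpx.2])
      rw [abs_mul, abs_of_nonneg (by positivity)]
      calc p x * ‖gradient u x‖ ^ (p x - 2) * |⟪gradient u x, gradient ψ x⟫|
          ≤ p x * ‖gradient u x‖ ^ (p x - 2) * (‖gradient u x‖ * ‖gradient ψ x‖) := by
            gcongr
            exact abs_real_inner_le_norm _ _
        _ = p x * ‖gradient u x‖ ^ (p x - 1) * ‖gradient ψ x‖ := by rw [← h1]; ring
        _ ≤ pp * max G 1 ^ pp * K := by
            gcongr
            · exact hpx.2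
            · exact hψG x
  have hAint : IntegrableOn (fun x => ‖gradient u x‖ ^ p x * η x ^ pp) Ω volume := by
    refine integrableOn_of_bounded_of_eq_zero hηc.isCompact
      (C := max G 1 ^ pp) ?_ ?_ ?_
    · exact ((hgu.norm.pow hp).mul (hηm.pow_const pp)).aestronglyMeasurable
    · refine ae_of_all _ fun x hx => ?_
      simp [image_eq_zero_of_notMem_tsupport hx, Real.zero_rpow hpp0.ne']
    · filter_upwards [hpb] with x hpx hx
      have h1 : ‖gradient u x‖ ^ p x ≤ max G 1 ^ pp :=
        rpow_le_max_one_rpow (norm_nonneg _) (hG x hx) (by linarith [hpx.1]) hpx.2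
      have h2 := hζ01 x
      simp only [hζ] at h2
      rw [abs_of_nonneg (mul_nonneg (by positivity) h2.1)]
      calc _ ≤ max G 1 ^ pp * 1 := by
            exact mul_le_mul h1 h2.2 h2.1 (by positivity)
        _ = _ := mul_one _
  have hBint : IntegrableOn (fun x => |u x| ^ p x * ‖gradient η x‖ ^ p x) Ω volume := by
    refine integrableOn_of_bounded_of_eq_zero hηc.isCompact
      (C := max M 1 ^ pp * max D 1 ^ pp) ?_ ?_ ?_
    · exact ((hum.abs.pow hp.aemeasurable).mul
        (hgη.norm.pow hp).aemeasurable).aestronglyMeasurable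
    · filter_upwards [hpb] with x hpx hx
      have : p x ≠ 0 := (by linarith [hpx.1] : (0 : ℝ) < p x).ne'
      simp [hgrad0 subset_rfl x hx, Real.zero_rpow this]
    · filter_upwards [hpb, ae_restrict_mem hΩ.measurableSet] with x hpx hxΩ hx
      have hp0 : 0 ≤ p x := by linarith [hpx.1]
      rw [abs_of_nonneg (by positivity)]
      exact mul_le_mul (rpow_le_max_one_rpow (abs_nonneg _) (hM x hxΩ) hp0 hpx.2)
        (rpow_le_max_one_rpow (norm_nonneg _) (hD x hx) hp0 hpx.2) (by positivity) (by positivity)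
  have hpt : ∀ᵐ x ∂(volume.restrict Ω), p x * ‖gradient u x‖ ^ (p x - 2) *
      ⟪gradient u x, gradient ψ x⟫ ≤
        pp ^ pp * (|u x| ^ p x * ‖gradient η x‖ ^ p x) - ‖gradient u x‖ ^ p x * η x ^ pp := by
    filter_upwards [hpb, ae_restrict_mem hΩ.measurableSet,
      huL.ae_differentiableAt (μ := volume) hΩ] with x hpx hxΩ hdiff
    have hgr := (hasGradientAt_neg_mul_rpow hpp.le hdiff
      (hη1.differentiable one_ne_zero x)).gradient
    rw [show gradient ψ x = _ from hgr, abs_of_nonpos (hu0 x hxΩ)]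
    exact caccioppoli_pointwise _ _ (hpm.trans_le hpx.1) hpx.2 (hη01 x).1 (hη01 x).2
      (neg_nonneg.2 (hu0 x hxΩ))
  have hle := hF0.trans (integral_mono_ae hFint ((hBint.const_mul (pp ^ pp)).sub hAint) hpt)
  simp only [Pi.sub_apply] at hle
  rw [integral_sub (hBint.const_mul (pp ^ pp)) hAint, integral_const_mul, sub_nonneg] at hle
  have hA0 : ∀ x, 0 ≤ ‖gradient u x‖ ^ p x * η x ^ pp := fun x =>
    mul_nonneg (by positivity) (hζ01 x).1
  have hB0 : ∀ x, 0 ≤ |u x| ^ p x * ‖gradient η x‖ ^ p x := fun x => by positivity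
  rw [← ofReal_integral_eq_lintegral_ofReal hAint (ae_of_all _ hA0),
    ← ofReal_integral_eq_lintegral_ofReal hBint (ae_of_all _ hB0),
    ← ENNReal.ofReal_mul (by positivity)]
  refine ENNReal.ofReal_le_ofReal (hle.trans ?_)
  exact mul_le_mul_of_nonneg_right (le_max_right _ _) (integral_nonneg hB0)
end

section
/- Let Ω ⊆ ℝⁿ be a measurable set and p : Ω → ℝ a measurable variable exponent with 1 < p⁻ ≤ p(x) ≤ p⁺ < ∞ for a.e. x ∈ Ω, where p⁻, p⁺ are constants, and let p'(x) = p(x)/(p(x)−1) be the pointwise conjugate exponent. Then for all measurable functions u, v on Ω, ∫_Ω |u(x) v(x)| dx ≤ 2 ‖u‖_{L^{p(·)}(Ω)} ‖v‖_{L^{p'(·)}(Ω)}. -/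
open MeasureTheory Filter Topology
open scoped ENNReal NNReal

/-- The Luxemburg norm `inf { λ > 0 : ∫_Ω |u(x)/λ|^{p(x)} dx ≤ 1 }` (with `inf ∅ = ∞`). -/
noncomputable def luxNorm {n : ℕ} (Ω : Set (EuclideanSpace ℝ (Fin n)))
    (p : EuclideanSpace ℝ (Fin n) → ℝ) (u : EuclideanSpace ℝ (Fin n) → ℝ) : ℝ≥0∞ :=
  ⨅ (l : ℝ) (_ : 0 < l ∧ (∫⁻ x in Ω, ENNReal.ofReal (|u x / l| ^ p x)) ≤ 1),
    ENNReal.ofReal l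

/-- A function of vanishing Luxemburg norm vanishes almost everywhere. -/
lemma ae_eq_zero_of_luxNorm_eq_zero {n : ℕ} {Ω : Set (EuclideanSpace ℝ (Fin n))}
    {q u : EuclideanSpace ℝ (Fin n) → ℝ} (hq : ∀ᵐ x ∂(volume.restrict Ω), 1 ≤ q x)
    (hu : Measurable u) (h : luxNorm Ω q u = 0) :
    ∀ᵐ x ∂(volume.restrict Ω), u x = 0 := by
  have key : ∀ ε : ℝ, 0 < ε → ∀ᵐ x ∂(volume.restrict Ω), |u x| ≤ ε := by
    intro ε hε
    have hint : ∫⁻ x in Ω, ENNReal.ofReal (|u x| - ε) = 0 := by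
      refine le_antisymm (le_of_forall_gt fun c hc => ?_) bot_le
      have hlt : luxNorm Ω q u < min c (ENNReal.ofReal ε) := by
        rw [h]
        exact lt_min hc (ENNReal.ofReal_pos.2 hε)
      simp only [luxNorm, iInf_lt_iff] at hlt
      obtain ⟨l, ⟨hl, hmod⟩, hlt⟩ := hlt
      have hlε : l < ε := (ENNReal.ofReal_lt_ofReal_iff hε).1 (hlt.trans_le (min_le_right _ _))
      refine lt_of_le_of_lt ?_ (hlt.trans_le (min_le_left _ _))
      calc ∫⁻ x in Ω, ENNReal.ofReal (|u x| - ε)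
          ≤ ∫⁻ x in Ω, ENNReal.ofReal l * ENNReal.ofReal (|u x / l| ^ q x) := by
            refine lintegral_mono_ae ?_
            filter_upwards [hq] with x hx
            rw [← ENNReal.ofReal_mul hl.le]
            refine ENNReal.ofReal_le_ofReal ?_
            have hpow : |u x / l| - 1 ≤ |u x / l| ^ q x := by
              rcases le_total |u x / l| 1 with h1 | h1
              · exact (sub_nonpos.2 h1).trans (by positivity)
              · exact (sub_le_self _ zero_le_one).trans (Real.self_le_rpow_of_one_le h1 hx)
            have hmul := mul_le_mul_of_nonneg_left hpow hl.le
            rw [abs_div, abs_of_pos hl, mul_sub, mul_div_cancel₀ _ hl.ne', mul_one] at hmul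
            rw [abs_div, abs_of_pos hl]
            linarith
        _ = ENNReal.ofReal l * ∫⁻ x in Ω, ENNReal.ofReal (|u x / l| ^ q x) :=
            lintegral_const_mul' _ _ ENNReal.ofReal_ne_top
        _ ≤ ENNReal.ofReal l := mul_le_of_le_one_right' hmod
    rw [lintegral_eq_zero_iff (by fun_prop)] at hint
    filter_upwards [hint] with x hx
    simpa using hx
  have hall : ∀ᵐ x ∂(volume.restrict Ω), ∀ k : ℕ, |u x| ≤ 1 / ((k : ℝ) + 1) :=
    ae_all_iff.2 fun k => key _ Nat.one_div_pos_of_nat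
  filter_upwards [hall] with x hx
  exact abs_nonpos_iff.1
    (ge_of_tendsto' tendsto_one_div_add_atTop_nhds_zero_nat hx)

/-- Young's inequality integrated against functions with modular at most one. -/
lemma lintegral_abs_mul_le_of_modular_le_one {n : ℕ} {Ω : Set (EuclideanSpace ℝ (Fin n))}
    {p u v : EuclideanSpace ℝ (Fin n) → ℝ} (hpmeas : Measurable p)
    (hp : ∀ᵐ x ∂(volume.restrict Ω), 1 < p x) (hu : Measurable u) {l m : ℝ}
    (hl : 0 < l) (hm : 0 < m)
    (hul : ∫⁻ x in Ω, ENNReal.ofReal (|u x / l| ^ p x) ≤ 1)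
    (hvm : ∫⁻ x in Ω, ENNReal.ofReal (|v x / m| ^ (p x / (p x - 1))) ≤ 1) :
    ∫⁻ x in Ω, ENNReal.ofReal |u x * v x| ≤ 2 * ENNReal.ofReal l * ENNReal.ofReal m := by
  calc ∫⁻ x in Ω, ENNReal.ofReal |u x * v x|
      ≤ ∫⁻ x in Ω, ENNReal.ofReal (l * m) * (ENNReal.ofReal (|u x / l| ^ p x) +
          ENNReal.ofReal (|v x / m| ^ (p x / (p x - 1)))) := by
        refine lintegral_mono_ae ?_
        filter_upwards [hp] with x hx
        have hconj : (p x).HolderConjugate (p x / (p x - 1)) :=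
          Real.HolderConjugate.conjExponent hx
        rw [← ENNReal.ofReal_add (by positivity) (by positivity),
          ← ENNReal.ofReal_mul (by positivity)]
        refine ENNReal.ofReal_le_ofReal ?_
        have hyoung := Real.young_inequality_of_nonneg (abs_nonneg (u x / l))
          (abs_nonneg (v x / m)) hconj
        have h1 : |u x / l| ^ p x / p x ≤ |u x / l| ^ p x :=
          div_le_self (by positivity) hx.le
        have h2 : |v x / m| ^ (p x / (p x - 1)) / (p x / (p x - 1)) ≤
            |v x / m| ^ (p x / (p x - 1)) :=
          div_le_self (by positivity) hconj.symm.lt.le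
        calc |u x * v x| = l * m * (|u x / l| * |v x / m|) := by
              rw [abs_mul, abs_div, abs_div, abs_of_pos hl, abs_of_pos hm]
              field_simp
          _ ≤ _ := mul_le_mul_of_nonneg_left (by linarith) (by positivity)
    _ = ENNReal.ofReal (l * m) * ((∫⁻ x in Ω, ENNReal.ofReal (|u x / l| ^ p x)) +
          ∫⁻ x in Ω, ENNReal.ofReal (|v x / m| ^ (p x / (p x - 1)))) := by
        rw [lintegral_const_mul' _ _ ENNReal.ofReal_ne_top,
          lintegral_add_left (by fun_prop)]
    _ ≤ ENNReal.ofReal (l * m) * (1 + 1) := by gcongr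
    _ = 2 * ENNReal.ofReal l * ENNReal.ofReal m := by
        rw [ENNReal.ofReal_mul hl.le, one_add_one_eq_two]
        ring

/-- Hölder's inequality for variable exponent Lebesgue spaces:
`∫_Ω |u v| dx ≤ 2 ‖u‖_{L^{p(·)}(Ω)} ‖v‖_{L^{p'(·)}(Ω)}`, where
`p'(x) = p(x)/(p(x)-1)` is the pointwise conjugate exponent. -/
theorem holder_variable_exponent
    {n : ℕ}
    (Ω : Set (EuclideanSpace ℝ (Fin n))) (hΩ : MeasurableSet Ω)
    (p : EuclideanSpace ℝ (Fin n) → ℝ) (hpmeas : Measurable p)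
    (pm pp : ℝ) (hpm : 1 < pm) (hpmpp : pm ≤ pp)
    (hbd : ∀ᵐ x ∂(volume.restrict Ω), pm ≤ p x ∧ p x ≤ pp)
    (u v : EuclideanSpace ℝ (Fin n) → ℝ) (humeas : Measurable u) (hvmeas : Measurable v) :
    (∫⁻ x in Ω, ENNReal.ofReal |u x * v x|) ≤
      2 * luxNorm Ω p u * luxNorm Ω (fun x => p x / (p x - 1)) v := by
  have hp : ∀ᵐ x ∂(volume.restrict Ω), 1 < p x := hbd.mono fun x hx => hpm.trans_le hx.1
  have hp' : ∀ᵐ x ∂(volume.restrict Ω), 1 ≤ p x / (p x - 1) :=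
    hp.mono fun x hx => (Real.HolderConjugate.conjExponent hx).symm.lt.le
  by_cases hu0 : luxNorm Ω p u = 0
  · have hae := ae_eq_zero_of_luxNorm_eq_zero (hp.mono fun _ => le_of_lt) humeas hu0
    rw [lintegral_congr_ae (g := 0) (hae.mono fun x hx => by simp [hx])]
    simp
  by_cases hv0 : luxNorm Ω (fun x => p x / (p x - 1)) v = 0
  · have hae := ae_eq_zero_of_luxNorm_eq_zero hp' hvmeas hv0
    rw [lintegral_congr_ae (g := 0) (hae.mono fun x hx => by simp [hx])]
    simp
  by_cases hut : luxNorm Ω p u = ⊤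
  · rw [hut, ENNReal.mul_top two_ne_zero, ENNReal.top_mul hv0]
    exact le_top
  have h2u0 : 2 * luxNorm Ω p u ≠ 0 := mul_ne_zero two_ne_zero hu0
  have h2ut : 2 * luxNorm Ω p u ≠ ⊤ := ENNReal.mul_ne_top ENNReal.ofNat_ne_top hut
  rw [← ENNReal.div_le_iff' h2u0 h2ut]
  refine le_iInf₂ fun m hm => ?_
  have h2m0 : 2 * ENNReal.ofReal m ≠ 0 :=
    mul_ne_zero two_ne_zero (ENNReal.ofReal_pos.2 hm.1).ne'
  have h2mt : 2 * ENNReal.ofReal m ≠ ⊤ :=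
    ENNReal.mul_ne_top ENNReal.ofNat_ne_top ENNReal.ofReal_ne_top
  rw [ENNReal.div_le_iff' h2u0 h2ut, mul_right_comm, ← ENNReal.div_le_iff' h2m0 h2mt]
  refine le_iInf₂ fun l hl => ?_
  rw [ENNReal.div_le_iff' h2m0 h2mt, mul_right_comm]
  exact lintegral_abs_mul_le_of_modular_le_one hpmeas hp humeas hl.1 hm.1 hl.2 hm.2
end
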